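/- arXiv:1911.00796 — 3 statements merged into one kernel-verified Lean document; each statement's English description precedes it below -/
import Mathlib

section
/- Let f be a feasible integral circulation on the circulation network G_c and let K = Σ_i f(s,o_i) be the total amount of flow on the arcs leaving the dummy vertex s. Then the set of arcs carrying flow, {a : f(a) = 1}, is the disjoint union of the arc sets of exactly K directed cycles of G_c; in particular these K cycles are pairwise arc-disjoint and each of them contains s. -/
/-- Arcs of the circulation network `G_c`.
Vertices are `Option (Fin N × Bool)`: `none` is the dummy vertex `s`,
`some (i, false)` is the pre-node `o_i`, `some (i, true)` is the post-node `h_i`. -/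
def IsArc {N : ℕ} (A : Set (Fin N × Fin N)) :
    Option (Fin N × Bool) → Option (Fin N × Bool) → Prop
  | none, none => False
  | none, some (_, b) => b = false
  | some (_, b), none => b = true
  | some (i, b), some (j, b') =>
      (b = false ∧ b' = true ∧ i = j) ∨ (b = true ∧ b' = false ∧ (i, j) ∈ A)

/-- A directed cycle in a directed graph with arc relation `arc`:
a sequence `v 0, v 1, …, v k` with `k ≥ 1`, `v 0 = v k`, each consecutive pair an arc,
and `v 0, …, v (k-1)` pairwise distinct. -/
structure DiCycle {α : Type*} (arc : α → α → Prop) where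
  k : ℕ
  pos : 1 ≤ k
  v : ℕ → α
  closed : v 0 = v k
  arcs : ∀ m < k, arc (v m) (v (m + 1))
  distinct : ∀ m₁ < k, ∀ m₂ < k, v m₁ = v m₂ → m₁ = m₂

/-- The arc set of a directed cycle. -/
def DiCycle.arcSet {α : Type*} {arc : α → α → Prop} (c : DiCycle arc) : Set (α × α) :=
  {a | ∃ m < c.k, a = (c.v m, c.v (m + 1))}

/-- A finite relation `R` in which every vertex `v ≠ s` met by `R` has exactly one successor and
exactly one predecessor, and which has a potential `φ` increasing along arcs avoiding `s`,
decomposes into directed cycles through `s`, one for each successor of `s`. -/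
theorem exists_diCycle_decomposition {V : Type*} [Finite V] {arc R : V → V → Prop}
    (hR : ∀ v w, R v w → arc v w) (s : V) (φ : V → ℕ)
    (hφ : ∀ v w, v ≠ s → w ≠ s → R v w → φ v < φ w)
    (hout : ∀ v w, w ≠ s → R v w → ∃ x, R w x)
    (hin : ∀ v w, v ≠ s → R v w → ∃ u, R u v)
    (hout_unique : ∀ v w w', v ≠ s → R v w → R v w' → w = w')
    (hin_unique : ∀ u u' v, v ≠ s → R u v → R u' v → u = u') :
    ∃ C : {w // R s w} → DiCycle arc,
      (∀ a b, a ≠ b → Disjoint (C a).arcSet (C b).arcSet) ∧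
      (⋃ a, (C a).arcSet) = {p | R p.1 p.2} ∧ ∀ a, (C a).v 0 = s := by
  classical
  obtain ⟨next, hnext⟩ : ∃ next : V → V, ∀ v w, R v w → R v (next v) := by
    refine ⟨fun v => if h : ∃ w, R v w then h.choose else v, fun v w h => ?_⟩
    have h' : ∃ w, R v w := ⟨w, h⟩
    simpa [h'] using h'.choose_spec
  let u : {w // R s w} → ℕ → V := fun a m => match m with
    | 0 => s
    | n + 1 => next^[n] a.1
  have u_zero : ∀ a, u a 0 = s := fun a => rfl
  have u_succ : ∀ a n, u a (n + 2) = next (u a (n + 1)) := fun a n =>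
    Function.iterate_succ_apply' next n a.1
  have step : ∀ a n, (∀ m, 1 ≤ m → m ≤ n → u a m ≠ s) → R (u a n) (u a (n + 1)) := by
    intro a n
    induction n with
    | zero => intro _; exact a.2
    | succ n ih =>
      intro h
      obtain ⟨x, hx⟩ := hout _ _ (h (n + 1) (by omega) le_rfl)
        (ih fun m h1 h2 => h m h1 (by omega))
      rw [u_succ]
      exact hnext _ _ hx
  have hmono : ∀ a k, (∀ m, 1 ≤ m → m < k → u a m ≠ s) →
      ∀ m n, 1 ≤ m → m < n → n < k → φ (u a m) < φ (u a n) := by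
    intro a k h m n hm hmn
    induction n, hmn using Nat.le_induction with
    | base =>
      exact fun hk => hφ _ _ (h _ hm (by omega)) (h _ (by omega) hk)
        (step a m fun j h1 h2 => h j h1 (by omega))
    | succ n hn ih =>
      exact fun hk => (ih (by omega)).trans
        (hφ _ _ (h _ (by omega) (by omega)) (h _ (by omega) hk)
          (step a n fun j h1 h2 => h j h1 (by omega)))
  have hret : ∀ a, ∃ k, 1 ≤ k ∧ u a k = s := by
    intro a
    by_contra! h
    refine not_injective_infinite_finite (fun n => u a (n + 1)) ?_
    have : StrictMono fun n => φ (u a (n + 1)) := fun m n hmn =>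
      hmono a (n + 2) (fun j h1 _ => h j h1) (m + 1) (n + 1) (by omega) (by omega) (by omega)
    exact fun m n hmn => this.injective (congrArg φ hmn)
  have hk : ∀ a, ∃ k, 1 ≤ k ∧ u a k = s ∧ ∀ m, 1 ≤ m → m < k → u a m ≠ s := by
    intro a
    obtain ⟨h1, h2⟩ := Nat.find_spec (hret a)
    exact ⟨_, h1, h2, fun m hm hlt h => Nat.find_min (hret a) hlt ⟨hm, h⟩⟩
  choose k k_pos k_spec k_min using hk
  have hstep : ∀ a m, m < k a → R (u a m) (u a (m + 1)) := fun a m hm =>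
    step a m fun j h1 h2 => k_min a j h1 (by omega)
  have hs_iff : ∀ a m, m < k a → u a m = s → m = 0 := fun a m hm h => by
    by_contra h0
    exact k_min a m (by omega) hm h
  have hmeet : ∀ a b m n, m + 1 < k a → n + 1 < k b → u a (m + 1) = u b (n + 1) → a = b := by
    intro a b m
    induction m with
    | zero =>
      intro n hm hn h
      have h1 := hstep b n (by omega)
      rw [← h] at h1
      have h2 := hin_unique _ _ _ (k_min a _ (by omega) hm) h1 (hstep a 0 (by omega))
      obtain rfl := hs_iff b n (by omega) h2
      exact Subtype.ext h
    | succ m ih =>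
      intro n hm hn h
      have h1 := hstep b n (by omega)
      rw [← h] at h1
      have h2 := hin_unique _ _ _ (k_min a _ (by omega) hm) h1 (hstep a (m + 1) (by omega))
      cases n with
      | zero => exact absurd h2.symm (k_min a (m + 1) (by omega) (by omega))
      | succ n => exact ih n (by omega) (by omega) h2.symm
  have hcover : ∀ d v w, φ v = d → v ≠ s → R v w → ∃ a m, m < k a ∧ u a m = v := by
    intro d
    induction d using Nat.strong_induction_on with
    | _ d ih =>
      intro v w hd hv hvw
      obtain ⟨p, hp⟩ := hin v w hv hvw
      suffices ∃ a m, m < k a ∧ u a (m + 1) = v by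
        obtain ⟨a, m, hm, h⟩ := this
        refine ⟨a, m + 1, lt_of_le_of_ne hm fun h' => hv ?_, h⟩
        rw [← h, ← k_spec a, ← h']
      by_cases hps : p = s
      · subst hps
        exact ⟨⟨v, hp⟩, 0, k_pos _, rfl⟩
      · obtain ⟨a, m, hm, h⟩ := ih _ (hd ▸ hφ _ _ hps hv hp) p v rfl hps hp
        refine ⟨a, m, hm, hout_unique p _ _ hps ?_ hp⟩
        rw [← h]
        exact hstep a m hm
  refine ⟨fun a => ⟨k a, k_pos a, u a, (u_zero a).trans (k_spec a).symm,
    fun m hm => hR _ _ (hstep a m hm), ?_⟩, ?_, ?_, u_zero⟩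
  · intro m hm n hn h
    rcases Nat.eq_zero_or_pos m with rfl | hm0
    · exact (hs_iff a n hn h.symm).symm
    rcases Nat.eq_zero_or_pos n with rfl | hn0
    · exact hs_iff a m hm h
    rcases lt_trichotomy m n with hmn | hmn | hmn
    · exact absurd (congrArg φ h) (hmono a (k a) (k_min a) m n hm0 hmn hn).ne
    · exact hmn
    · exact absurd (congrArg φ h) (hmono a (k a) (k_min a) n m hn0 hmn hm).ne'
  · intro a b hab
    rw [Set.disjoint_left]
    rintro _ ⟨m, hm, rfl⟩ ⟨n, hn, h⟩
    simp only [Prod.mk.injEq] at h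
    obtain ⟨h1, h2⟩ := h
    change m < k a at hm
    change n < k b at hn
    apply hab
    cases m with
    | zero =>
      obtain rfl := hs_iff b n hn h1.symm
      exact Subtype.ext h2
    | succ m =>
      cases n with
      | zero => exact absurd (hs_iff a _ hm h1) (by omega)
      | succ n => exact hmeet a b m n hm hn h1
  · ext ⟨v, w⟩
    simp only [Set.mem_iUnion, Set.mem_ofPred_eq]
    constructor
    · rintro ⟨a, m, hm, h⟩
      simp only [Prod.mk.injEq] at h
      rw [h.1, h.2]
      exact hstep a m hm
    · intro h
      by_cases hv : v = s
      · subst hv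
        exact ⟨⟨w, h⟩, 0, k_pos _, rfl⟩
      · obtain ⟨a, m, hm, rfl⟩ := hcover _ v w rfl hv h
        exact ⟨a, m, hm, Prod.ext rfl (hout_unique _ _ _ hv h (hstep a m hm))⟩

/-- At most one unit of an integral circulation on `G_c` passes through a detection node. -/
theorem sum_outflow_le_one {N : ℕ} {A : Set (Fin N × Fin N)}
    {f : Option (Fin N × Bool) → Option (Fin N × Bool) → ℕ}
    (hf01 : ∀ v w, f v w ≤ 1) (hsupp : ∀ v w, ¬ IsArc A v w → f v w = 0)
    (hcons : ∀ v, ∑ w, f w v = ∑ w, f v w) (x : Fin N × Bool) :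
    ∑ w, f (some x) w ≤ 1 := by
  obtain ⟨i, _ | _⟩ := x
  · rw [Finset.sum_eq_single (some (i, true)) _ (by simp)]
    · exact hf01 _ _
    · rintro (_ | ⟨j, _ | _⟩) - h <;> apply hsupp <;> simp_all [IsArc, eq_comm]
  · rw [← hcons, Finset.sum_eq_single (some (i, false)) _ (by simp)]
    · exact hf01 _ _
    · rintro (_ | ⟨j, _ | _⟩) - h <;> apply hsupp <;> simp_all [IsArc]

/-- A family of naturals with sum at most one takes the value one at most once. -/
theorem eq_of_sum_le_one {α : Type*} [Fintype α] {g : α → ℕ} (h : ∑ x, g x ≤ 1) {x y : α}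
    (hx : g x = 1) (hy : g y = 1) : x = y := by
  classical
  by_contra hxy
  have := Finset.sum_le_sum_of_subset (f := g) (Finset.subset_univ {x, y})
  rw [Finset.sum_pair hxy] at this
  omega

/-- A `0`-`1`-valued family with the same sum as one taking the value one takes it too. -/
theorem exists_eq_one_of_sum_eq {α : Type*} [Fintype α] {g g' : α → ℕ}
    (h : ∑ x, g x = ∑ x, g' x) (hg' : ∀ x, g' x ≤ 1) {x : α} (hx : g x = 1) :
    ∃ y, g' y = 1 := by
  have hpos : 0 < ∑ x, g' x := by
    rw [← h]
    exact Finset.sum_pos' (fun _ _ => Nat.zero_le _) ⟨x, Finset.mem_univ x, by omega⟩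
  obtain ⟨y, -, hy⟩ := Finset.exists_ne_zero_of_sum_ne_zero hpos.ne'
  exact ⟨y, by have := hg' y; omega⟩

/-- A feasible integral circulation on the circulation network, with total flow `K`
leaving the dummy vertex `s`, has its support `{a : f a = 1}` equal to the disjoint
union of the arc sets of exactly `K` directed cycles; these cycles are pairwise
arc-disjoint and each of them contains `s`. -/
theorem circulation_decomposes_into_K_cycles
    (N : ℕ) (t : Fin N → ℕ) (A : Set (Fin N × Fin N))
    (hA : ∀ p ∈ A, t p.1 < t p.2)
    (f : Option (Fin N × Bool) → Option (Fin N × Bool) → ℕ)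
    (hf01 : ∀ v w, f v w ≤ 1)
    (hsupp : ∀ v w, ¬ IsArc A v w → f v w = 0)
    (hcons : ∀ v, ∑ w, f w v = ∑ w, f v w)
    (K : ℕ) (hK : K = ∑ i, f none (some (i, false))) :
    ∃ C : Fin K → DiCycle (IsArc A),
      (∀ a b, a ≠ b → Disjoint (C a).arcSet (C b).arcSet) ∧
      (⋃ a, (C a).arcSet) = {p | f p.1 p.2 = 1} ∧
      (∀ a, ∃ m ≤ (C a).k, (C a).v m = none) := by
  classical
  have harc : ∀ v w, f v w = 1 → IsArc A v w := fun v w h => by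
    by_contra h'
    have := hsupp v w h'
    omega
  have hle : ∀ v, v ≠ none → ∑ w, f v w ≤ 1 := by
    rintro (_ | x) h
    · exact absurd rfl h
    · exact sum_outflow_le_one hf01 hsupp hcons x
  obtain ⟨C, hdisj, hcov, hC⟩ := exists_diCycle_decomposition (R := fun v w => f v w = 1)
    harc none (fun v => v.elim 0 fun x => 2 * t x.1 + x.2.toNat)
    (by
      rintro (_ | ⟨i, b⟩) (_ | ⟨j, b'⟩) hv hw h
      · exact absurd rfl hv
      · exact absurd rfl hv
      · exact absurd rfl hw
      · rcases harc _ _ h with ⟨rfl, rfl, rfl⟩ | ⟨rfl, rfl, hij⟩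
        · simp
        · have := hA _ hij
          simp only [Option.elim, Bool.toNat_true, Bool.toNat_false] at this ⊢
          omega)
    (fun v w _ h => exists_eq_one_of_sum_eq (hcons w) (hf01 w) h)
    (fun v w _ h => exists_eq_one_of_sum_eq (hcons v).symm (fun u => hf01 u v) h)
    (fun v _ _ hv h h' => eq_of_sum_le_one (hle v hv) h h')
    (fun _ _ v hv h h' =>
      eq_of_sum_le_one (g := fun u => f u v) ((hcons v).trans_le (hle v hv)) h h')
  have hcard : Fintype.card {w // f none w = 1} = K := by
    have hsum : ∑ w, f none w = K := by
      have h0 : f none none = 0 := hsupp _ _ id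
      have h1 : ∀ i, f none (some (i, true)) = 0 := fun i => hsupp _ _ (by simp [IsArc])
      simp [hK, Fintype.sum_option, Fintype.sum_prod_type, h0, h1]
    rw [← hsum, Fintype.card_subtype, Finset.card_filter]
    refine Finset.sum_congr rfl fun w _ => ?_
    have := hf01 none w
    split_ifs <;> omega
  let e := (Fintype.equivFinOfCardEq hcard).symm
  refine ⟨C ∘ e, fun a b hab => hdisj _ _ (e.injective.ne hab), ?_,
    fun a => ⟨0, Nat.zero_le _, hC _⟩⟩
  rw [← hcov]
  exact e.surjective.iUnion_comp fun a => (C a).arcSet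
end

section
/- Let G = (V,E) be a finite directed graph with unit capacities, c an antisymmetric cost function, ε > 0, and p_0, p : V → ℝ price functions. Let f_0 be an integral pseudoflow that is 2ε-optimal with respect to p_0, and let f be an integral pseudoflow that is ε-optimal with respect to p. Then for all vertices v, w with f(v,w) > f_0(v,w) we have p(w) - p_0(w) ≥ p(v) - p_0(v) - 3ε; equivalently, writing d(x) = (p(x) - p_0(x))/ε, we have d(w) ≥ d(v) - 3. -/
/-- On a finite directed graph with unit capacities `u(v,w) = 1` if `(v,w) ∈ E` and `0`
otherwise, let `f₀` be an integral pseudoflow that is `2ε`-optimal with respect to the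
price function `p₀` and `f` an integral pseudoflow that is `ε`-optimal with respect to
`p`. Then `f v w > f₀ v w` implies `p w - p₀ w ≥ p v - p₀ v - 3ε` (i.e., with
`d(x) = (p(x) - p₀(x))/ε`, `d(w) ≥ d(v) - 3`). -/
theorem price_increase_along_flow_difference
    {V : Type*} [Fintype V] [DecidableEq V] (E : Finset (V × V))
    (c : V → V → ℝ) (hc : ∀ v w, c w v = - c v w)
    (ε : ℝ) (hε : 0 < ε) (p₀ p : V → ℝ)
    (f₀ f : V → V → ℤ)
    (hf₀anti : ∀ v w, f₀ v w = - f₀ w v)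
    (hf₀cap : ∀ v w, f₀ v w ≤ if (v, w) ∈ E then 1 else 0)
    (hfanti : ∀ v w, f v w = - f w v)
    (hfcap : ∀ v w, f v w ≤ if (v, w) ∈ E then 1 else 0)
    (hf₀opt : ∀ v w, f₀ v w < (if (v, w) ∈ E then 1 else 0) →
      c v w + p₀ v - p₀ w ≥ -(2 * ε))
    (hfopt : ∀ v w, f v w < (if (v, w) ∈ E then 1 else 0) →
      c v w + p v - p w ≥ -ε) :
    ∀ v w, f₀ v w < f v w → p w - p₀ w ≥ p v - p₀ v - 3 * ε := by
  intro v w h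
  have h₀ := hf₀opt v w (h.trans_le (hfcap v w))
  have hrev : f w v < f₀ w v := by
    rw [hfanti w v, hf₀anti w v]
    exact neg_lt_neg h
  have h₁ := hfopt w v (hrev.trans_le (hf₀cap w v))
  rw [hc v w] at h₁
  linarith
end

section
/- Let G = (V,E) be a finite directed graph with unit capacities containing no pair of anti-parallel arcs (if (v,w) ∈ E then (w,v) ∉ E). Let f_0 be an integral circulation on G, let f be an integral pseudoflow on G, and let X ⊆ V be a set of vertices that contains every deficit node of f and contains no excess node of f. Then the total excess of f is at most the number of ordered pairs (v,w) with v ∈ X, w ∉ X, and f(v,w) > f_0(v,w). -/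
/-- The sum of an antisymmetric function over a square `S × S` vanishes. -/
theorem sum_sum_eq_zero_of_antisymm {V : Type*} (S : Finset V) (d : V → V → ℤ)
    (hd : ∀ v w, d v w = - d w v) : ∑ v ∈ S, ∑ w ∈ S, d w v = 0 := by
  have h : ∑ v ∈ S, ∑ w ∈ S, d w v = - ∑ v ∈ S, ∑ w ∈ S, d w v := by
    conv_lhs => rw [Finset.sum_comm]
    simp only [← Finset.sum_neg_distrib]
    exact Finset.sum_congr rfl fun v _ => Finset.sum_congr rfl fun w _ => hd v w
  linarith

/-- On a finite directed graph with unit capacities and no pair of anti-parallel arcs,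
let `f₀` be an integral circulation, `f` an integral pseudoflow, and `X` a set of
vertices containing every deficit node of `f` and no excess node of `f`. Then the
total excess of `f` is at most the number of pairs `(v,w)` with `v ∈ X`, `w ∉ X`, and
`f v w > f₀ v w`. (The excess of `v` is `e_f(v) = Σ_w f w v`.) -/
theorem total_excess_le_crossing_arcs
    {V : Type*} [Fintype V] [DecidableEq V] (E : Finset (V × V))
    (hE : ∀ v w, (v, w) ∈ E → (w, v) ∉ E)
    (f₀ f : V → V → ℤ)
    (hf₀anti : ∀ v w, f₀ v w = - f₀ w v)
    (hf₀cap : ∀ v w, f₀ v w ≤ if (v, w) ∈ E then 1 else 0)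
    (hf₀circ : ∀ v, ∑ w, f₀ w v = 0)
    (hfanti : ∀ v w, f v w = - f w v)
    (hfcap : ∀ v w, f v w ≤ if (v, w) ∈ E then 1 else 0)
    (X : Finset V)
    (hdef : ∀ v, (∑ w, f w v) < 0 → v ∈ X)
    (hexc : ∀ v, 0 < (∑ w, f w v) → v ∉ X) :
    (∑ v ∈ Finset.univ.filter (fun v => 0 < ∑ w, f w v), ∑ w, f w v)
      ≤ ((Finset.univ.filter
          (fun p : V × V => p.1 ∈ X ∧ p.2 ∉ X ∧ f₀ p.1 p.2 < f p.1 p.2)).card : ℤ) := by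
  have hd_le : ∀ v w, f v w - f₀ v w ≤ 1 := by
    intro v w
    have h₁ := hfcap v w
    have h₂ := hf₀cap w v
    have h₃ := hf₀anti v w
    have h₄ := hE v w
    split_ifs at h₁ h₂ <;> first | omega | tauto
  have hexcess : (∑ v ∈ Finset.univ.filter (fun v => 0 < ∑ w, f w v), ∑ w, f w v)
      = ∑ v ∈ Xᶜ, ∑ w, f w v := by
    refine Finset.sum_subset (fun v hv => ?_) (fun v hv hv' => ?_)
    · exact Finset.mem_compl.2 (hexc v (Finset.mem_filter.1 hv).2)
    · have h₁ : ¬ (∑ w, f w v) < 0 := fun h => Finset.mem_compl.1 hv (hdef v h)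
      have h₂ : ¬ 0 < ∑ w, f w v := by simpa using hv'
      omega
  have hcross : ∑ v ∈ Xᶜ, ∑ w, f w v = ∑ v ∈ Xᶜ, ∑ w ∈ X, (f w v - f₀ w v) := by
    have hzero := sum_sum_eq_zero_of_antisymm Xᶜ (fun v w => f v w - f₀ v w)
      (fun v w => by rw [hfanti v w, hf₀anti v w]; ring)
    have hsplit : ∑ v ∈ Xᶜ, ∑ w, f w v = ∑ v ∈ Xᶜ,
        (∑ w ∈ X, (f w v - f₀ w v) + ∑ w ∈ Xᶜ, (f w v - f₀ w v)) := by
      refine Finset.sum_congr rfl fun v _ => ?_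
      rw [Finset.sum_add_sum_compl, Finset.sum_sub_distrib, hf₀circ v, sub_zero]
    rw [hsplit, Finset.sum_add_distrib, hzero, add_zero]
  have hcard : Finset.univ.filter
      (fun p : V × V => p.1 ∈ X ∧ p.2 ∉ X ∧ f₀ p.1 p.2 < f p.1 p.2)
      = (X ×ˢ Xᶜ).filter (fun p => f₀ p.1 p.2 < f p.1 p.2) := by
    ext p
    simp [and_assoc]
  rw [hexcess, hcross, Finset.sum_comm, ← Finset.sum_product', hcard, Finset.card_filter,
    Nat.cast_sum]
  refine Finset.sum_le_sum fun p _ => ?_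
  have := hd_le p.1 p.2
  split_ifs <;> push_cast <;> omega
end
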